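/- Let (W, S) be a Coxeter system and I ⊆ S. Then the set 𝒲_I, consisting of all w ∈ W such that w W_I w⁻¹ = W_I and w has minimal length in the coset w W_I (i.e. ℓ(w) ≤ ℓ(wu) for all u ∈ W_I), is a subgroup of W. -/

import Mathlib

/-- The standard parabolic subgroup `W_I` of a Coxeter system, generated by the
simple reflections indexed by `I`. -/
def CoxeterSystem.parabolic {B W : Type*} [Group W] {M : CoxeterMatrix B}
    (cs : CoxeterSystem M W) (I : Set B) : Subgroup W :=
  Subgroup.closure (cs.simple '' I)

/-- The set `𝒲_I` of all `w ∈ W` such that `w W_I w⁻¹ = W_I` and `w` has minimal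
length in the coset `w W_I`. -/
def CoxeterSystem.minNormalizing {B W : Type*} [Group W] {M : CoxeterMatrix B}
    (cs : CoxeterSystem M W) (I : Set B) : Set W :=
  {w : W | (cs.parabolic I).map (MulAut.conj w).toMonoidHom = cs.parabolic I ∧
    ∀ u ∈ cs.parabolic I, cs.length w ≤ cs.length (w * u)}

namespace CoxeterSystem

variable {B W : Type*} [Group W] {M : CoxeterMatrix B} (cs : CoxeterSystem M W)

open Classical in
/-- The involution `(t, e) ↦ (sᵢ t sᵢ, e + [t = sᵢ])` of `W × ZMod 2`. -/
noncomputable def signedConj (i : B) : Equiv.Perm (W × ZMod 2) :=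
  Function.Involutive.toPerm
    (fun p => (cs.simple i * p.1 * cs.simple i, p.2 + if p.1 = cs.simple i then 1 else 0)) <| by
    rintro ⟨t, e⟩
    have h : cs.simple i * t * cs.simple i = cs.simple i ↔ t = cs.simple i := by
      rw [mul_eq_right, mul_eq_one_iff_inv_eq, cs.inv_simple, eq_comm]
    ext
    · simp [mul_assoc]
    · simp only [h, add_assoc, CharTwo.add_self_eq_zero, add_zero]

open Classical in
theorem signedConj_apply (i : B) (p : W × ZMod 2) :
    cs.signedConj i p =
      (cs.simple i * p.1 * cs.simple i, p.2 + if p.1 = cs.simple i then 1 else 0) := rfl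

open Classical in
theorem signedConj_mul_pow_apply (i j : B) (n : ℕ) (t : W) (e : ZMod 2) :
    ((cs.signedConj i * cs.signedConj j) ^ n) (t, e) =
      ((cs.simple i * cs.simple j) ^ n * t * ((cs.simple i * cs.simple j) ^ n)⁻¹,
        e + ∑ k ∈ Finset.range (2 * n),
          if t = cs.simple j * (cs.simple i * cs.simple j) ^ k then 1 else 0) := by
  induction n with
  | zero => simp
  | succ n ih =>
    set r := cs.simple i * cs.simple j with hr
    have hj : cs.simple j * r * cs.simple j = r⁻¹ := by simp [hr, mul_assoc]
    have hflip (k : ℕ) : cs.simple j * r ^ k = (r ^ k)⁻¹ * cs.simple j := by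
      rw [← inv_pow, ← hj]
      have : cs.simple j * r * cs.simple j = cs.simple j * r * (cs.simple j)⁻¹ := by simp
      rw [this, conj_pow]
      simp
    have h1 : r ^ n * t * (r ^ n)⁻¹ = cs.simple j ↔ t = cs.simple j * r ^ (2 * n) := by
      rw [two_mul, pow_add, ← mul_assoc, hflip]
      constructor
      · intro h
        rw [← h]
        group
      · intro h
        rw [h]
        group
    have h2 : cs.simple j * (r ^ n * t * (r ^ n)⁻¹) * cs.simple j = cs.simple i ↔
        t = cs.simple j * r ^ (2 * n + 1) := by
      have hi : cs.simple i = r * cs.simple j := by simp [hr]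
      have e1 : cs.simple j * r ^ (2 * n + 1) = (r ^ n)⁻¹ * (cs.simple j * r) * r ^ n := by
        rw [← mul_assoc, ← hflip, two_mul, add_assoc, pow_add, pow_succ']
        simp only [mul_assoc]
      rw [e1, hi]
      constructor
      · intro h
        have h' := mul_right_cancel h
        have h3 : r ^ n * t * (r ^ n)⁻¹ = cs.simple j * r := by
          simpa using congrArg (cs.simple j * ·) h'
        rw [← h3]
        group
      · intro h
        rw [h]
        have h3 : r ^ n * ((r ^ n)⁻¹ * (cs.simple j * r) * r ^ n) * (r ^ n)⁻¹ =
            cs.simple j * r := by group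
        rw [h3, cs.simple_mul_simple_cancel_left]
    rw [pow_succ', Equiv.Perm.mul_apply, ih, Equiv.Perm.mul_apply, signedConj_apply,
      signedConj_apply]
    ext
    · have : r⁻¹ = cs.simple j * cs.simple i := by simp [hr]
      simp only [pow_succ', mul_inv_rev, this]
      simp only [hr, mul_assoc]
    · have e2 : 2 * (n + 1) = 2 * n + 1 + 1 := by ring
      rw [e2, Finset.sum_range_succ, Finset.sum_range_succ]
      simp only [h1, h2, add_assoc]

theorem isLiftable_signedConj : M.IsLiftable cs.signedConj := by
  classical
  intro i j
  ext1 ⟨t, e⟩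
  rw [signedConj_mul_pow_apply, two_mul, Finset.sum_range_add]
  simp [pow_add, CharTwo.add_self_eq_zero]

/-- The action of `W` on `W × ZMod 2` extending `signedConj`. -/
noncomputable def signedConjHom : W →* Equiv.Perm (W × ZMod 2) :=
  cs.lift ⟨cs.signedConj, cs.isLiftable_signedConj⟩

theorem signedConjHom_simple (i : B) : cs.signedConjHom (cs.simple i) = cs.signedConj i :=
  cs.lift_apply_simple cs.isLiftable_signedConj i

/-- The reflection cocycle: `1` if `t` is a right inversion of `w`, and `0` otherwise. -/
noncomputable def inversionParity (w t : W) : ZMod 2 := (cs.signedConjHom w (t, 0)).2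

theorem signedConjHom_apply (w t : W) (e : ZMod 2) :
    cs.signedConjHom w (t, e) = (w * t * w⁻¹, e + cs.inversionParity w t) := by
  classical
  induction w using cs.simple_induction_left generalizing e with
  | one => simp [inversionParity]
  | mul_simple_left w i ih =>
    rw [inversionParity, map_mul, Equiv.Perm.mul_apply, Equiv.Perm.mul_apply, ih, ih,
      signedConjHom_simple, signedConj_apply, signedConj_apply]
    simp [mul_assoc, add_assoc]

theorem inversionParity_mul (x y t : W) :
    cs.inversionParity (x * y) t =
      cs.inversionParity y t + cs.inversionParity x (y * t * y⁻¹) := by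
  rw [inversionParity, map_mul, Equiv.Perm.mul_apply, signedConjHom_apply, signedConjHom_apply,
    zero_add]

@[simp]
theorem inversionParity_one (t : W) : cs.inversionParity 1 t = 0 := by
  simp [inversionParity]

open Classical in
theorem inversionParity_simple (i : B) (t : W) :
    cs.inversionParity (cs.simple i) t = if t = cs.simple i then 1 else 0 := by
  simp [inversionParity, signedConjHom_simple, signedConj_apply]

theorem mem_rightInvSeq_of_inversionParity_ne_zero (ω : List B) (t : W)
    (h : cs.inversionParity (cs.wordProd ω) t ≠ 0) : t ∈ cs.rightInvSeq ω := by
  classical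
  induction ω with
  | nil => simp at h
  | cons i ω ih =>
    rw [rightInvSeq, List.mem_cons]
    by_contra! hn
    apply h
    rw [wordProd_cons, inversionParity_mul, not_not.mp (mt ih hn.2), zero_add,
      inversionParity_simple, if_neg]
    intro h'
    apply hn.1
    rw [← h']
    group

theorem length_mul_lt_of_inversionParity_ne_zero {w t : W} (h : cs.inversionParity w t ≠ 0) :
    cs.length (w * t) < cs.length w := by
  obtain ⟨ω, hω, rfl⟩ := cs.exists_isReduced w
  exact (cs.isRightInversion_of_mem_rightInvSeq hω
    (cs.mem_rightInvSeq_of_inversionParity_ne_zero ω t h)).2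

theorem inversionParity_ne_zero_of_isRightDescent {w : W} {i : B} (h : cs.IsRightDescent w i) :
    cs.inversionParity w (cs.simple i) ≠ 0 := by
  have h0 : cs.inversionParity (w * cs.simple i) (cs.simple i) = 0 := by
    by_contra hn
    have := cs.length_mul_lt_of_inversionParity_ne_zero hn
    rw [cs.simple_mul_simple_cancel_right] at this
    exact lt_asymm h this
  rw [inversionParity_mul, inversionParity_simple] at h0
  simp only [if_true, mul_inv_cancel_right] at h0
  intro h1
  simp [h1] at h0

theorem mem_parabolic_of_inversionParity_ne_zero {I : Set B} {u : W} (hu : u ∈ cs.parabolic I) :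
    ∀ t, cs.inversionParity u t ≠ 0 → t ∈ cs.parabolic I := by
  classical
  induction hu using Subgroup.closure_induction with
  | mem x hx =>
    obtain ⟨i, hi, rfl⟩ := hx
    intro t ht
    rw [inversionParity_simple] at ht
    rw [show t = cs.simple i by simpa using ht]
    exact Subgroup.subset_closure ⟨i, hi, rfl⟩
  | one => simp
  | mul x y hx hy ihx ihy =>
    intro t ht
    by_contra hn
    apply ht
    rw [inversionParity_mul, not_not.mp (mt (ihy t) hn), zero_add]
    by_contra h
    apply hn
    have : y⁻¹ * (y * t * y⁻¹) * y ∈ cs.parabolic I :=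
      mul_mem (mul_mem (inv_mem hy) (ihx _ h)) hy
    simpa [mul_assoc] using this
  | inv x hx ih =>
    intro t ht
    have h := cs.inversionParity_mul x x⁻¹ t
    rw [mul_inv_cancel, inversionParity_one, inv_inv] at h
    have h' : cs.inversionParity x (x⁻¹ * t * x) ≠ 0 := by
      intro h0
      rw [h0, add_zero] at h
      exact ht h.symm
    have : x * (x⁻¹ * t * x) * x⁻¹ ∈ cs.parabolic I :=
      mul_mem (mul_mem hx (ih _ h')) (inv_mem hx)
    simpa [mul_assoc] using this

theorem eq_one_of_inversionParity_eq_zero {I : Set B} {u : W} (hu : u ∈ cs.parabolic I)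
    (h : ∀ t ∈ cs.parabolic I, cs.inversionParity u t = 0) : u = 1 := by
  by_contra hne
  obtain ⟨i, hi⟩ := cs.exists_rightDescent_of_ne_one hne
  have hi' := cs.inversionParity_ne_zero_of_isRightDescent hi
  exact hi' (h _ (cs.mem_parabolic_of_inversionParity_ne_zero hu _ hi'))

/-- An element `w` has minimal length in `w W_I` if and only if no reflection in `W_I` is a
right inversion of `w`. -/
theorem forall_length_le_mul_iff (I : Set B) (w : W) :
    (∀ u ∈ cs.parabolic I, cs.length w ≤ cs.length (w * u)) ↔
      ∀ t ∈ cs.parabolic I, cs.inversionParity w t = 0 := by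
  have key (w : W) (hw : ∀ u ∈ cs.parabolic I, cs.length w ≤ cs.length (w * u)) (t : W)
      (ht : t ∈ cs.parabolic I) : cs.inversionParity w t = 0 := by
    by_contra h
    exact (hw t ht).not_gt (cs.length_mul_lt_of_inversionParity_ne_zero h)
  refine ⟨key w, fun h => ?_⟩
  obtain ⟨v, hv⟩ := exists_minimal_of_wellFoundedLT
    (fun n => ∃ u ∈ cs.parabolic I, cs.length (w * u) = n) ⟨_, 1, one_mem _, rfl⟩
  obtain ⟨u, hu, rfl⟩ := hv.prop
  have hmin : ∀ x ∈ cs.parabolic I, cs.length (w * u) ≤ cs.length (w * u * x) := by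
    intro x hx
    by_contra! hlt
    exact hlt.not_ge (hv.le_of_le ⟨u * x, mul_mem hu hx, by rw [mul_assoc]⟩ hlt.le)
  have hu1 : u = 1 := by
    refine cs.eq_one_of_inversionParity_eq_zero hu fun t ht => ?_
    have h1 := key _ hmin t ht
    rwa [inversionParity_mul, h _ (mul_mem (mul_mem hu ht) (inv_mem hu)), add_zero] at h1
  simpa [hu1] using hmin

end CoxeterSystem

/-- For a Coxeter system `(W, S)` and `I ⊆ S`, the set `𝒲_I` of
minimal-length elements normalizing `W_I` is a subgroup of `W`. -/
theorem minNormalizing_isSubgroup {B W : Type*} [Group W] {M : CoxeterMatrix B}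
    (cs : CoxeterSystem M W) (I : Set B) :
    ∃ H : Subgroup W, (H : Set W) = cs.minNormalizing I := by
  have hmem (w : W) : w ∈ cs.minNormalizing I ↔ (∀ u, u ∈ cs.parabolic I ↔
      w * u * w⁻¹ ∈ cs.parabolic I) ∧ ∀ t ∈ cs.parabolic I, cs.inversionParity w t = 0 := by
    rw [← cs.forall_length_le_mul_iff, ← Subgroup.mem_normalizer_iff,
      Subgroup.mem_normalizer_iff_map_conj_eq]
    rfl
  refine ⟨{ carrier := cs.minNormalizing I, one_mem' := ?_, mul_mem' := ?_, inv_mem' := ?_ }, rfl⟩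
  · intro x y hx hy
    rw [hmem] at hx hy ⊢
    refine ⟨fun u => ?_, fun t ht => ?_⟩
    · rw [hy.1, hx.1]
      simp [mul_assoc]
    · rw [cs.inversionParity_mul, hy.2 t ht, hx.2 _ ((hy.1 t).1 ht), add_zero]
  · rw [hmem]
    simp
  · intro x hx
    rw [hmem] at hx ⊢
    have hinv (u : W) : u ∈ cs.parabolic I ↔ x⁻¹ * u * x⁻¹⁻¹ ∈ cs.parabolic I := by
      rw [hx.1 (x⁻¹ * u * x⁻¹⁻¹)]
      simp [mul_assoc]
    refine ⟨hinv, fun t ht => ?_⟩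
    have h := cs.inversionParity_mul x x⁻¹ t
    rwa [mul_inv_cancel, cs.inversionParity_one, hx.2 _ ((hinv t).1 ht), add_zero, eq_comm] at h
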